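/- arXiv:2407.04497 — 2 statements merged into one kernel-verified Lean document; each statement's English description precedes it below -/
import Mathlib

section
/- Let (B, M) be a reduced local (Noetherian) ring containing the rational numbers such that B/M is uncountable and |B| = |B/M|. Suppose the set Min(B) of minimal prime ideals of B is partitioned into m ≥ 1 subcollections C₁, …, C_m. Then there exists a reduced local subring S ⊆ B with maximal ideal S ∩ M such that: (1) S contains the rationals; (2) the completion of S with respect to S ∩ M is equal to the completion of B with respect to M; (3) S/(S ∩ M) is uncountable and |S| = |S/(S ∩ M)|; (4) for Q, Q′ ∈ Min(B), one has Q ∩ S = Q′ ∩ S if and only if there is an i ∈ {1, …, m} with Q ∈ Cᵢ and Q′ ∈ Cᵢ; (5) the map f : Spec(B) → Spec(S) given by f(P) = S ∩ P is onto, and if P is a prime ideal of B of positive height then f(P)B = P; in particular, if P and P′ are prime ideals of B of positive height, then f(P) has positive height and f(P) = f(P′) implies P = P′. -/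
/-!
Theorem 2.14 of [Gluing2021]: gluing minimal primes of a reduced local ring while
preserving the completion.

Conventions: a "local ring" is a commutative Noetherian ring with exactly one maximal
ideal.  "The completion of `S` equals the completion of `B`" is formalized as: there is
a ring isomorphism between the two maximal-ideal-adic completions that is compatible
with the inclusion `S ⊆ B`.  "Contains the rationals" is formalized via the (unique)
ring homomorphism from `ℚ`.  The height of a prime ideal `P` is formalized as the
height of the corresponding point of the prime spectrum, i.e. the supremum of lengths
of chains of primes descending from `P`.
-/

universe u

open IsLocalRing

/-- residues avoiding algebraic relations -/
theorem glue_step {B : Type u} [CommRing B] [IsLocalRing B] [IsNoetherianRing B]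
    (hunc : Cardinal.aleph0 < Cardinal.mk (ResidueField B))
    (Y : Set B) (hY : Cardinal.mk Y < Cardinal.mk (ResidueField B)) (b c : B) :
    ∃ x : B, ∀ Q ∈ minimalPrimes B, b ∉ Q →
      ∀ f : Polynomial (Algebra.adjoin ℤ Y), Polynomial.aeval (c + b * x) f ∈ Q →
        ∀ n, (f.coeff n : B) ∈ Q := by
  classical
  set R := Algebra.adjoin ℤ Y with hR
  have hRc : Cardinal.mk R < Cardinal.mk (ResidueField B) := by
    have h := Algebra.lift_cardinalMk_adjoin_le ℤ Y
    simp only [Cardinal.mk_int, Cardinal.lift_aleph0, Cardinal.lift_uzero] at h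
    exact h.trans_lt (by simp [hunc, hY])
  have hPc : Cardinal.mk (Polynomial R) < Cardinal.mk (ResidueField B) :=
    Polynomial.cardinalMk_le_max.trans_lt (by simp [hunc, hRc])
  have hfin : (minimalPrimes B).Finite := minimalPrimes.finite_of_isNoetherianRing B
  have : Finite (minimalPrimes B) := hfin
  -- bad residues
  let g : ∀ (Q : Ideal B), Polynomial R → Polynomial (B ⧸ Q) := fun Q f =>
    (f.map ((Ideal.Quotient.mk Q).comp (algebraMap R B))).comp
      (Polynomial.C (Ideal.Quotient.mk Q c) + Polynomial.C (Ideal.Quotient.mk Q b) * Polynomial.X)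
  let Bad : (minimalPrimes B × Polynomial R) → Set (ResidueField B) := fun p =>
    {r | g p.1 p.2 ≠ 0 ∧ ∃ x : B, residue B x = r ∧
      (g p.1 p.2).eval (Ideal.Quotient.mk _ x) = 0}
  have hBad : ∀ p, (Bad p).Countable := by
    rintro ⟨⟨Q, hQ⟩, f⟩
    by_cases h0 : g Q f = 0
    · have : Bad (⟨Q, hQ⟩, f) = ∅ := by
        ext r; simp [Bad, h0]
      rw [this]; exact Set.countable_empty
    have : Q.IsPrime := hQ.1.1
    have hQM : Q ≤ maximalIdeal B := IsLocalRing.le_maximalIdeal this.ne_top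
    refine Set.Countable.mono (s₂ := (Ideal.Quotient.factor hQM) '' {a | (g Q f).IsRoot a}) ?_ ?_
    · rintro r ⟨-, x, rfl, hx⟩
      exact ⟨Ideal.Quotient.mk _ x, hx, rfl⟩
    · exact ((Polynomial.finite_setOfPred_isRoot h0).image _).countable
  have hU : Cardinal.mk (⋃ p, Bad p) < Cardinal.mk (ResidueField B) := by
    refine (Cardinal.mk_iUnion_le Bad).trans_lt ?_
    refine Cardinal.mul_lt_of_lt hunc.le ?_ ?_
    · rw [Cardinal.mk_prod, Cardinal.lift_id, Cardinal.lift_id]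
      exact Cardinal.mul_lt_of_lt hunc.le ((Cardinal.lt_aleph0_of_finite _).trans hunc) hPc
    · refine lt_of_le_of_lt (ciSup_le' fun p => ?_) hunc
      exact (hBad p).le_aleph0
  obtain ⟨r, hr⟩ : ∃ r, r ∉ ⋃ p, Bad p := by
    by_contra! h
    rw [Set.eq_univ_of_forall h, Cardinal.mk_univ] at hU
    exact hU.false
  obtain ⟨x, rfl⟩ := IsLocalRing.residue_surjective r
  refine ⟨x, fun Q hQ hb f hf n => ?_⟩
  have : Q.IsPrime := hQ.1.1
  have h1 : g Q f = 0 := by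
    by_contra h0
    apply hr
    refine Set.mem_iUnion.2 ⟨(⟨Q, hQ⟩, f), h0, x, rfl, ?_⟩
    rw [← Ideal.Quotient.eq_zero_iff_mem] at hf
    rw [← hf]
    simp only [g, Polynomial.eval_comp, Polynomial.eval_map, Polynomial.aeval_def,
      Polynomial.hom_eval₂]
    simp
  have h2 : f.map ((Ideal.Quotient.mk Q).comp (algebraMap R B)) = 0 := by
    have hb' : Ideal.Quotient.mk Q b ≠ 0 := by
      rwa [Ne, Ideal.Quotient.eq_zero_iff_mem]
    rcases Polynomial.comp_eq_zero_iff.1 h1 with h | ⟨-, h⟩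
    · exact h
    · exfalso
      have := congrArg (fun p => Polynomial.coeff p 1) h
      simp [hb', Polynomial.coeff_C] at this
  have h3 := congrArg (fun p => Polynomial.coeff p n) h2
  simp only [Polynomial.coeff_map, Polynomial.coeff_zero, RingHom.comp_apply] at h3
  rwa [Ideal.Quotient.eq_zero_iff_mem] at h3

def GlueCons {B : Type u} [CommRing B] {m : ℕ} (C : Fin m → Set (Ideal B)) (z : B) : Prop :=
  ∀ i, ∀ Q ∈ C i, ∀ Q' ∈ C i, z ∈ Q → z ∈ Q'

def GlueAdm {B : Type u} [CommRing B] {m : ℕ} (C : Fin m → Set (Ideal B)) (b c : B) : Prop :=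
  ∀ i, (∀ Q ∈ C i, b ∉ Q) ∨ (∀ Q ∈ C i, b ∈ Q ∧ c ∈ Q)

theorem glue_cons_insert {B : Type u} [CommRing B] {m : ℕ} (C : Fin m → Set (Ideal B))
    (Y Y' : Set B) (y : B) (hYY : Y ⊆ Y')
    (hY : ∀ z ∈ Algebra.adjoin ℤ Y, GlueCons C z)
    (hy : ∀ i, (∀ Q ∈ C i, ∀ f : Polynomial (Algebra.adjoin ℤ Y'), Polynomial.aeval y f ∈ Q →
        ∀ n, (f.coeff n : B) ∈ Q) ∨ ∀ Q ∈ C i, y ∈ Q) :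
    ∀ z ∈ Algebra.adjoin ℤ (insert y Y), GlueCons C z := by
  have key : ∀ z ∈ Algebra.adjoin ℤ (insert y Y), ∃ f : Polynomial (Algebra.adjoin ℤ Y),
      Polynomial.aeval y f = z := by
    intro z hz
    have : Algebra.adjoin ℤ (insert y Y) ≤
        ((Polynomial.aeval (R := Algebra.adjoin ℤ Y) y).restrictScalars ℤ).range := by
      refine Algebra.adjoin_le ?_
      rintro w (rfl | hw)
      · exact ⟨Polynomial.X, by simp⟩
      · exact ⟨Polynomial.C ⟨w, Algebra.subset_adjoin hw⟩, by simp⟩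
    exact this hz
  intro z hz i Q hQ Q' hQ' hzQ
  obtain ⟨f, rfl⟩ := key z hz
  rcases hy i with h | h
  · have hc : ∀ n, (f.coeff n : B) ∈ Q' := by
      intro n
      refine hY _ (f.coeff n).2 i Q hQ Q' hQ' ?_
      have := h Q hQ (f.map (Subalgebra.inclusion (Algebra.adjoin_mono hYY)).toRingHom) (by
        rw [Polynomial.aeval_def, Polynomial.eval₂_map]
        exact hzQ) n
      rw [Polynomial.coeff_map] at this
      exact this
    rw [Polynomial.aeval_eq_sum_range]
    refine Ideal.sum_mem _ fun n _ => ?_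
    rw [Algebra.smul_def]
    exact Ideal.mul_mem_right _ _ (hc n)
  · have hd : ∀ P : Ideal B, y ∈ P → (Polynomial.aeval y f ∈ P ↔ (f.coeff 0 : B) ∈ P) := by
      intro P hP
      have e : Polynomial.aeval y f = y * Polynomial.aeval y f.divX + (f.coeff 0 : B) := by
        conv_lhs => rw [← Polynomial.X_mul_divX_add f]
        rw [map_add, map_mul, Polynomial.aeval_X, Polynomial.aeval_C]
        rfl
      rw [e]
      exact Ideal.add_mem_iff_right _ (Ideal.mul_mem_right _ _ hP)
    rw [hd _ (h Q' hQ')]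
    rw [hd _ (h Q hQ)] at hzQ
    exact hY _ (f.coeff 0).2 i Q hQ Q' hQ' hzQ

theorem glue_exists {B : Type u} [CommRing B] [IsLocalRing B] [IsNoetherianRing B]
    [Algebra ℚ B] (hunc : Cardinal.aleph0 < Cardinal.mk (ResidueField B))
    (hcard : Cardinal.mk B = Cardinal.mk (ResidueField B))
    {m : ℕ} (C : Fin m → Set (Ideal B)) (hC : ∀ i, C i ⊆ minimalPrimes B) :
    ∃ S : Subring B, (∀ z ∈ S, GlueCons C z) ∧
      ∀ b c, GlueAdm C b c → ∃ x, c + b * x ∈ S := by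
  classical
  obtain ⟨lo, wf, ho⟩ := Cardinal.exists_ord_eq_type_lt (B × B)
  have hBB : Cardinal.mk (B × B) = Cardinal.mk (ResidueField B) := by
    rw [Cardinal.mk_prod, Cardinal.lift_id, hcard]
    exact Cardinal.mul_eq_self hunc.le
  have hsmall : ∀ (a : B × B) (h : B × B → B), Cardinal.mk (h '' Set.Iio a) <
      Cardinal.mk (ResidueField B) := by
    intro a h
    refine Cardinal.mk_image_le.trans_lt ?_
    rw [← hBB]
    exact Cardinal.mk_Iio_lt a ho
  have step : ∀ (a : B × B) (ih : ∀ a' : B × B, a' < a → B), ∃ x : B,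
      ∀ Q ∈ minimalPrimes B, a.1 ∉ Q → ∀ f : Polynomial (Algebra.adjoin ℤ
        ((fun a' => if h : a' < a then ih a' h else 0) '' Set.Iio a)),
          Polynomial.aeval (a.2 + a.1 * x) f ∈ Q → ∀ n, (f.coeff n : B) ∈ Q :=
    fun a ih => glue_step hunc _ (hsmall a _) _ _
  let y : B × B → B := WellFounded.fix (wellFounded_lt (α := B × B))
    (fun a ih => a.2 + a.1 * (step a ih).choose)
  have hy : ∀ a, ∃ x, y a = a.2 + a.1 * x ∧ 
      ∀ Q ∈ minimalPrimes B, a.1 ∉ Q → ∀ f : Polynomial (Algebra.adjoin ℤ (y '' Set.Iio a)),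
          Polynomial.aeval (a.2 + a.1 * x) f ∈ Q → ∀ n, (f.coeff n : B) ∈ Q := by
    intro a
    refine ⟨(step a (fun a' _ => y a')).choose, ?_, ?_⟩
    · exact WellFounded.fix_eq _ _ _
    · have h := (step a (fun a' _ => y a')).choose_spec
      have e : ((fun a' => if h : a' < a then y a' else 0) '' Set.Iio a) = y '' Set.Iio a := by
        refine Set.image_congr fun a' ha' => ?_
        simp [Set.mem_Iio.1 ha']
      revert h
      generalize (step a (fun a' _ => y a')).choose = x
      intro h
      rw [e] at h
      exact h
  -- finite subsets of admissible indices
  have hfin : ∀ T : Finset (B × B), (∀ a ∈ T, GlueAdm C a.1 a.2) →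
      ∀ z ∈ Algebra.adjoin ℤ (y '' (T : Set (B × B))), GlueCons C z := by
    intro T
    induction T using Finset.induction_on_max with
    | empty =>
      intro _ z hz i Q hQ Q' hQ' hzQ
      simp only [Finset.coe_empty, Set.image_empty, Algebra.adjoin_empty] at hz
      obtain ⟨k, rfl⟩ := Algebra.mem_bot.1 hz
      by_cases hk : k = 0
      · simp [hk]
      · exfalso
        have hQp : Q.IsPrime := (hC i hQ).1.1
        refine hQp.ne_top (Ideal.eq_top_of_isUnit_mem _ hzQ ?_)
        have : IsUnit (algebraMap ℚ B (k : ℚ)) :=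
          (IsUnit.mk0 _ (by exact_mod_cast hk)).map _
        simpa using this
    | insert a T hlt ih =>
      intro hadm
      have h1 := ih (fun a' ha' => hadm a' (Finset.mem_insert_of_mem ha'))
      rw [Finset.coe_insert, Set.image_insert_eq]
      obtain ⟨x, hx, hx'⟩ := hy a
      refine glue_cons_insert C _ (y '' Set.Iio a) _ (Set.image_mono fun t ht => hlt t ht) h1 ?_
      intro i
      rcases hadm a (Finset.mem_insert_self _ _) i with h | h
      · left
        intro Q hQ f hf
        rw [hx] at hf
        exact hx' Q (hC i hQ) (h Q hQ) f hf
      · right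
        intro Q hQ
        rw [hx]
        exact Q.add_mem (h Q hQ).2 (Q.mul_mem_right _ (h Q hQ).1)
  refine ⟨(Algebra.adjoin ℤ (y '' {a | GlueAdm C a.1 a.2})).toSubring, ?_, ?_⟩
  · intro z hz
    have hz' : z ∈ Algebra.adjoin ℤ (y '' {a | GlueAdm C a.1 a.2}) := hz
    have : ∃ T : Finset (B × B), (∀ a ∈ T, GlueAdm C a.1 a.2) ∧
        z ∈ Algebra.adjoin ℤ (y '' (T : Set (B × B))) := by
      clear hz
      induction hz' using Algebra.adjoin_induction with
      | mem w hw =>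
        obtain ⟨a, ha, rfl⟩ := hw
        exact ⟨{a}, by simpa using ha, Algebra.subset_adjoin (by simp)⟩
      | algebraMap r => exact ⟨∅, by simp, Subalgebra.algebraMap_mem _ _⟩
      | add w w' _ _ h h' =>
        obtain ⟨T, hT, hw⟩ := h
        obtain ⟨T', hT', hw'⟩ := h'
        refine ⟨T ∪ T', fun a ha => (Finset.mem_union.1 ha).elim (hT a) (hT' a), ?_⟩
        exact Subalgebra.add_mem _
          (Algebra.adjoin_mono (Set.image_mono (by simp)) hw)
          (Algebra.adjoin_mono (Set.image_mono (by simp)) hw')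
      | mul w w' _ _ h h' =>
        obtain ⟨T, hT, hw⟩ := h
        obtain ⟨T', hT', hw'⟩ := h'
        refine ⟨T ∪ T', fun a ha => (Finset.mem_union.1 ha).elim (hT a) (hT' a), ?_⟩
        exact Subalgebra.mul_mem _
          (Algebra.adjoin_mono (Set.image_mono (by simp)) hw)
          (Algebra.adjoin_mono (Set.image_mono (by simp)) hw')
    obtain ⟨T, hT, hzT⟩ := this
    exact hfin T hT z hzT
  · intro b c hbc
    obtain ⟨x, hx, -⟩ := hy (b, c)
    refine ⟨x, ?_⟩
    rw [← hx]
    exact Algebra.subset_adjoin ⟨(b, c), hbc, rfl⟩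

theorem glue_completion {A B : Type u} [CommRing A] [CommRing B] (f : A →+* B)
    (I : Ideal A) (J : Ideal B) (h : ∀ k, I ^ k = (J ^ k).comap f)
    (h' : ∀ k b, ∃ a, b - f a ∈ J ^ k) :
    ∃ e : AdicCompletion I A ≃+* AdicCompletion J B,
      ∀ a, e (algebraMap A (AdicCompletion I A) a) = algebraMap B (AdicCompletion J B) (f a) := by
  let φ₀ : ∀ k, A ⧸ I ^ k →+* B ⧸ J ^ k := fun k => Ideal.quotientMap (J ^ k) f (h k).le
  have hb : ∀ k, Function.Bijective (φ₀ k) := by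
    intro k
    refine ⟨Ideal.quotientMap_injective' (h k).ge, ?_⟩
    intro y
    obtain ⟨b, rfl⟩ := Ideal.Quotient.mk_surjective y
    obtain ⟨a, ha⟩ := h' k b
    refine ⟨Ideal.Quotient.mk _ a, ?_⟩
    rw [Ideal.quotientMap_mk]
    exact ((Ideal.Quotient.eq).2 ha).symm
  let φ : ∀ k, A ⧸ I ^ k ≃+* B ⧸ J ^ k := fun k => RingEquiv.ofBijective (φ₀ k) (hb k)
  have hφ : ∀ k a, φ k (Ideal.Quotient.mk _ a) = Ideal.Quotient.mk _ (f a) := fun k a => rfl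
  have hφc : ∀ {m n : ℕ} (hle : m ≤ n) (x : A ⧸ I ^ n),
      Ideal.Quotient.factorPow J hle (φ n x) = φ m (Ideal.Quotient.factorPow I hle x) := by
    intro m n hle x
    obtain ⟨a, rfl⟩ := Ideal.Quotient.mk_surjective x
    rfl
  have hev : ∀ {R : Type u} [CommRing R] (I : Ideal R) {m n : ℕ} (hle : m ≤ n)
      (x : AdicCompletion I R), Ideal.Quotient.factorPow I hle (AdicCompletion.evalₐ I n x) =
        AdicCompletion.evalₐ I m x := by
    intro R _ I m n hle x
    obtain ⟨c, rfl⟩ := AdicCompletion.mk_surjective I R x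
    rw [AdicCompletion.evalₐ_mk, AdicCompletion.evalₐ_mk]
    have := AdicCompletion.Ideal.mk_eq_mk I hle c
    rw [← this]
    rfl
  let F : AdicCompletion I A →+* AdicCompletion J B := AdicCompletion.liftRingHom J
    (fun n => (φ n : A ⧸ I ^ n →+* B ⧸ J ^ n).comp
      (AdicCompletion.evalₐ I n : AdicCompletion I A →+* A ⧸ I ^ n)) (by
      intro m n hle
      ext x
      simp only [RingHom.comp_apply, RingHom.coe_coe]
      rw [hφc, hev])
  let G : AdicCompletion J B →+* AdicCompletion I A := AdicCompletion.liftRingHom I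
    (fun n => ((φ n).symm : B ⧸ J ^ n →+* A ⧸ I ^ n).comp
      (AdicCompletion.evalₐ J n : AdicCompletion J B →+* B ⧸ J ^ n)) (by
      intro m n hle
      ext x
      simp only [RingHom.comp_apply, RingHom.coe_coe]
      apply (φ m).injective
      rw [← hφc]
      simp [hev])
  have hF : ∀ n x, AdicCompletion.evalₐ J n (F x) = φ n (AdicCompletion.evalₐ I n x) := by
    intro n x; simp [F]
  have hG : ∀ n x, AdicCompletion.evalₐ I n (G x) = (φ n).symm (AdicCompletion.evalₐ J n x) := by
    intro n x; simp [G]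
  refine ⟨RingEquiv.ofRingHom F G ?_ ?_, ?_⟩
  · ext1 x
    apply AdicCompletion.ext_evalₐ
    intro n
    simp [hF, hG]
  · ext1 x
    apply AdicCompletion.ext_evalₐ
    intro n
    simp [hF, hG]
  · intro a
    apply AdicCompletion.ext_evalₐ
    intro n
    have : AdicCompletion.evalₐ J n (F (algebraMap A (AdicCompletion I A) a)) =
      AdicCompletion.evalₐ J n (algebraMap B (AdicCompletion J B) (f a)) := by
      rw [hF, AlgHom.commutes, AlgHom.commutes]
      exact hφ n a
    exact this

def GlueReg {B : Type u} [CommRing B] (s : B) : Prop := ∀ Q ∈ minimalPrimes B, s ∉ Q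

theorem GlueReg.eq_zero {B : Type u} [CommRing B] [IsReduced B] {z : B}
    (h : ∀ Q ∈ minimalPrimes B, z ∈ Q) : z = 0 := by
  have h1 : z ∈ sInf ((⊥ : Ideal B).minimalPrimes) := by
    rw [Ideal.mem_sInf]
    intro Q hQ
    exact h Q hQ
  rw [Ideal.sInf_minimalPrimes] at h1
  obtain ⟨n, hn⟩ := h1
  exact IsReduced.eq_zero _ ⟨n, by simpa using hn⟩

theorem GlueReg.of_isUnit {B : Type u} [CommRing B] {s : B} (h : IsUnit s) : GlueReg s := by
  intro Q hQ hs
  exact hQ.1.1.ne_top (Ideal.eq_top_of_isUnit_mem _ hs h)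

theorem GlueReg.mul {B : Type u} [CommRing B] {s t : B} (h : GlueReg s) (h' : GlueReg t) :
    GlueReg (s * t) := by
  intro Q hQ hs
  rcases hQ.1.1.mem_or_mem hs with h1 | h1
  · exact h Q hQ h1
  · exact h' Q hQ h1

theorem GlueReg.pow {B : Type u} [CommRing B] {s : B} (h : GlueReg s) (k : ℕ) :
    GlueReg (s ^ k) := fun Q hQ hs => h Q hQ (hQ.1.1.mem_of_pow_mem k hs)

/-- an ideal not contained in any minimal prime contains a regular element -/
theorem glue_avoid {B : Type u} [CommRing B] [IsNoetherianRing B] (J : Ideal B)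
    (T : Set (Ideal B)) (hT : T ⊆ minimalPrimes B)
    (hJ : ∀ Q ∈ T, ¬ J ≤ Q) : ∃ r ∈ J, ∀ Q ∈ T, r ∉ Q := by
  by_contra! h
  have hfin : T.Finite := (minimalPrimes.finite_of_isNoetherianRing B).subset hT
  have := (Ideal.subset_union_prime_finite hfin (f := id) (I := J) ⊥ ⊥
    (fun Q hQ _ _ => (hT hQ).1.1)).1 (by
      intro r hr
      obtain ⟨Q, hQ, hrQ⟩ := h r hr
      exact Set.mem_biUnion hQ hrQ)
  obtain ⟨Q, hQ, hle⟩ := this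
  exact hJ Q hQ hle

/-- closure under division -/
theorem glue_exists_div {B : Type u} [CommRing B] [IsLocalRing B] [IsNoetherianRing B]
    [Algebra ℚ B] (hunc : Cardinal.aleph0 < Cardinal.mk (ResidueField B))
    (hcard : Cardinal.mk B = Cardinal.mk (ResidueField B))
    {m : ℕ} (C : Fin m → Set (Ideal B)) (hC : ∀ i, C i ⊆ minimalPrimes B) :
    ∃ S : Subring B, (∀ z ∈ S, GlueCons C z) ∧
      (∀ b c, GlueAdm C b c → ∃ x, c + b * x ∈ S) ∧
      (∀ s ∈ S, GlueReg s → ∀ b, s * b ∈ S → b ∈ S) := by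
  obtain ⟨S₀, h1, h2⟩ := glue_exists hunc hcard C hC
  let S : Subring B :=
    { carrier := {b | ∃ s ∈ S₀, GlueReg s ∧ s * b ∈ S₀}
      mul_mem' := by
        rintro a b ⟨s, hs, hr, ha⟩ ⟨t, ht, hr', hb⟩
        exact ⟨s * t, S₀.mul_mem hs ht, hr.mul hr', by
          rw [mul_mul_mul_comm]; exact S₀.mul_mem ha hb⟩
      one_mem' := ⟨1, S₀.one_mem, GlueReg.of_isUnit isUnit_one, by simp [S₀.one_mem]⟩
      add_mem' := by
        rintro a b ⟨s, hs, hr, ha⟩ ⟨t, ht, hr', hb⟩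
        refine ⟨s * t, S₀.mul_mem hs ht, hr.mul hr', ?_⟩
        have : s * t * (a + b) = t * (s * a) + s * (t * b) := by ring
        rw [this]
        exact S₀.add_mem (S₀.mul_mem ht ha) (S₀.mul_mem hs hb)
      zero_mem' := ⟨1, S₀.one_mem, GlueReg.of_isUnit isUnit_one, by simp [S₀.zero_mem]⟩
      neg_mem' := by
        rintro a ⟨s, hs, hr, ha⟩
        exact ⟨s, hs, hr, by rw [mul_neg]; exact S₀.neg_mem ha⟩ }
  have hle : ∀ z ∈ S₀, z ∈ S := fun z hz =>
    ⟨1, S₀.one_mem, GlueReg.of_isUnit isUnit_one, by simpa using hz⟩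
  refine ⟨S, ?_, ?_, ?_⟩
  · rintro z ⟨s, hs, hr, hz⟩ i Q hQ Q' hQ' hzQ
    have := h1 _ hz i Q hQ Q' hQ' (Q.mul_mem_left _ hzQ)
    exact ((hC i hQ').1.1.mem_or_mem this).resolve_left (hr _ (hC i hQ'))
  · intro b c hbc
    obtain ⟨x, hx⟩ := h2 b c hbc
    exact ⟨x, hle _ hx⟩
  · rintro s ⟨t, ht, hr, hts⟩ hs b ⟨t', ht', hr', hb⟩
    refine ⟨t' * (t * s), S₀.mul_mem ht' hts, hr'.mul (hr.mul hs), ?_⟩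
    have : t' * (t * s) * b = t * (t' * (s * b)) := by ring
    rw [this]
    exact S₀.mul_mem ht hb

theorem glue_comap_map {B : Type u} [CommRing B] (S : Subring B)
    (h2 : ∀ b, GlueReg b → ∀ c, ∃ x, c + b * x ∈ S)
    (h3 : ∀ s ∈ S, GlueReg s → ∀ b, s * b ∈ S → b ∈ S)
    (I : Ideal S) (s : S) (hs : s ∈ I) (hr : GlueReg (s : B)) :
    (I.map S.subtype).comap S.subtype = I := by
  refine le_antisymm ?_ Ideal.le_comap_map
  have key : ∀ z ∈ I.map S.subtype, ∃ i ∈ I, ∃ b : B, z = (i : B) + s * b := by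
    intro z hz
    induction hz using Submodule.span_induction with
    | mem z hz =>
      obtain ⟨i, hi, rfl⟩ := hz
      exact ⟨i, hi, 0, by simp⟩
    | zero => exact ⟨0, I.zero_mem, 0, by simp⟩
    | add z w _ _ hz hw =>
      obtain ⟨i, hi, b, rfl⟩ := hz
      obtain ⟨j, hj, c, rfl⟩ := hw
      exact ⟨i + j, I.add_mem hi hj, b + c, by push_cast; ring⟩
    | smul a z _ hz =>
      obtain ⟨i, hi, b, rfl⟩ := hz
      obtain ⟨x, hx⟩ := h2 s hr a
      refine ⟨⟨_, hx⟩ * i, I.mul_mem_left _ hi, a * b - x * i, ?_⟩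
      simp only [smul_eq_mul, Subring.coe_mul]
      ring
  intro z hz
  obtain ⟨i, hi, b, hb⟩ := key _ hz
  have hb' : (s : B) * b ∈ S := by
    have : (s : B) * b = ((z - i : S) : B) := by
      push_cast
      rw [eq_sub_iff_add_eq, add_comm, ← hb]; rfl
    rw [this]; exact (z - i).2
  have hbS := h3 s s.2 hr b hb'
  have : z = i + s * ⟨b, hbS⟩ := Subtype.ext hb
  rw [this]
  exact I.add_mem hi (I.mul_mem_right _ hs)

theorem glue_fg {B : Type u} [CommRing B] [IsNoetherianRing B] (S : Subring B)
    (h2 : ∀ b, GlueReg b → ∀ c, ∃ x, c + b * x ∈ S)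
    (h3 : ∀ s ∈ S, GlueReg s → ∀ b, s * b ∈ S → b ∈ S)
    (I : Ideal S) (s : S) (hs : s ∈ I) (hr : GlueReg (s : B)) : I.FG := by
  classical
  have h := IsNoetherian.noetherian (I.map S.subtype)
  obtain ⟨T, hT, hTe⟩ := (Submodule.fg_span_iff_fg_span_finset_subset _).1 h
  have hT' : ∀ t ∈ T, ∃ i, i ∈ I ∧ S.subtype i = t := fun t ht => hT ht
  choose! g hg hg' using hT'
  let J : Ideal S := Ideal.span (insert s (g '' (T : Set B)))
  have hsJ : s ∈ J := Ideal.subset_span (Set.mem_insert _ _)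
  have hJI : J ≤ I := by
    rw [Ideal.span_le]
    rintro z (rfl | ⟨t, ht, rfl⟩)
    · exact hs
    · exact hg t ht
  have hmap : I.map S.subtype ≤ J.map S.subtype := by
    change Submodule.span B (S.subtype '' (I : Set S)) ≤ _
    rw [hTe, Submodule.span_le]
    intro t ht
    have : S.subtype (g t) ∈ J.map S.subtype :=
      Ideal.mem_map_of_mem _ (Ideal.subset_span (Set.mem_insert_of_mem _ ⟨t, ht, rfl⟩))
    rwa [hg' t ht] at this
  have : I = J := by
    refine le_antisymm ?_ hJI
    rw [← glue_comap_map S h2 h3 J s hsJ hr]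
    exact Ideal.le_comap_map.trans (Ideal.comap_mono hmap)
  rw [this]
  exact Submodule.fg_span ((T.finite_toSet.image g).insert s)

theorem glue_setup {B : Type u} [CommRing B] [IsNoetherianRing B] [IsLocalRing B] [IsReduced B]
    [Algebra ℚ B] (hunc : Cardinal.aleph0 < Cardinal.mk (ResidueField B))
    (hcard : Cardinal.mk B = Cardinal.mk (ResidueField B))
    {m : ℕ} (C : Fin m → Set (Ideal B)) (hCne : ∀ i, (C i).Nonempty)
    (hCdisj : ∀ i j, i ≠ j → Disjoint (C i) (C j))
    (hCunion : (⋃ i, C i) = minimalPrimes B) :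
    ∃ S : Subring B, (∀ z ∈ S, GlueCons C z) ∧
      (∀ b, GlueReg b → ∀ c, ∃ x, c + b * x ∈ S) ∧
      (∀ s ∈ S, GlueReg s → ∀ b, s * b ∈ S → b ∈ S) ∧
      (∃ v : Fin m → S, ∀ i j, ∀ Q ∈ C j, (v i : B) ∈ Q ↔ i ≠ j) ∧
      (maximalIdeal B ∈ minimalPrimes B → S = ⊤) := by
  have hC : ∀ i, C i ⊆ minimalPrimes B := fun i => hCunion ▸ Set.subset_iUnion C i
  by_cases hM : maximalIdeal B ∈ minimalPrimes B
  · have huniq : ∀ Q ∈ minimalPrimes B, Q = maximalIdeal B := by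
      intro Q hQ
      have h := IsLocalRing.le_maximalIdeal hQ.1.1.ne_top
      exact le_antisymm h (hM.2 hQ.1 h)
    refine ⟨⊤, ?_, fun b _ c => ⟨0, trivial⟩, fun _ _ _ _ _ => trivial, ⟨fun _ => 1, ?_⟩,
      fun _ => rfl⟩
    · intro z _ i Q hQ Q' hQ' hz
      rw [huniq Q' (hC i hQ'), ← huniq Q (hC i hQ)]
      exact hz
    · intro i j Q hQ
      have hQm := hC j hQ
      constructor
      · intro h1
        exact absurd ((Ideal.eq_top_iff_one _).2 h1) hQm.1.1.ne_top
      · intro hij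
        exfalso
        obtain ⟨Q', hQ'⟩ := hCne i
        refine Set.disjoint_left.1 (hCdisj i j hij) hQ' ?_
        rw [huniq Q' (hC i hQ'), ← huniq Q hQm]
        exact hQ
  · obtain ⟨S, h1, h2, h3⟩ := glue_exists_div hunc hcard C hC
    refine ⟨S, h1, ?_, h3, ?_, fun h => absurd h hM⟩
    · intro b hb c
      exact h2 b c fun i => Or.inl fun Q hQ => hb Q (hC i hQ)
    · have hv : ∀ i, ∃ v : S, ∀ j, ∀ Q ∈ C j, (v : B) ∈ Q ↔ i ≠ j := by
        intro i
        obtain ⟨w, hwJ, hw⟩ := glue_avoid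
          (maximalIdeal B ⊓ (minimalPrimes.finite_of_isNoetherianRing B |>.sdiff (t := C i)
            |>.toFinset.inf id)) (C i) (hC i) (by
            intro Q hQ hle
            have hQp : Q.IsPrime := (hC i hQ).1.1
            rcases (hQp.inf_le).1 hle with h | h
            · have : Q = maximalIdeal B :=
                le_antisymm (IsLocalRing.le_maximalIdeal hQp.ne_top) h
              exact hM (this ▸ hC i hQ)
            · rw [Ideal.IsPrime.inf_le' hQp] at h
              obtain ⟨P, hP, hPQ⟩ := h
              rw [Set.Finite.mem_toFinset] at hP
              have : P = Q := le_antisymm hPQ ((hC i hQ).2 hP.1.1 hPQ)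
              exact hP.2 (this ▸ hQ))
        have hwM : w ∈ maximalIdeal B := hwJ.1
        have hw' : ∀ j, i ≠ j → ∀ Q ∈ C j, w ∈ Q := by
          intro j hij Q hQ
          have h := hwJ.2
          rw [SetLike.mem_coe, Submodule.mem_finsetInf] at h
          refine h Q ?_
          rw [Set.Finite.mem_toFinset]
          exact ⟨hC j hQ, fun hQi => Set.disjoint_left.1 (hCdisj i j hij) hQi hQ⟩
        obtain ⟨x, hx⟩ := h2 (w ^ 2) w (by
          intro j
          by_cases hij : i = j
          · subst hij
            exact Or.inl fun Q hQ h => hw Q hQ ((hC i hQ).1.1.mem_of_pow_mem 2 h)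
          · refine Or.inr fun Q hQ => ⟨?_, hw' j hij Q hQ⟩
            exact Ideal.pow_mem_of_mem _ (hw' j hij Q hQ) 2 (by norm_num))
        refine ⟨⟨_, hx⟩, fun j Q hQ => ⟨?_, ?_⟩⟩
        · rintro h rfl
          have hQp : Q.IsPrime := (hC i hQ).1.1
          have e : w + w ^ 2 * x = w * (1 + w * x) := by ring
          simp only [e] at h
          rcases hQp.mem_or_mem h with h | h
          · exact hw Q hQ h
          · have h5 : 1 + w * x ∈ maximalIdeal B := IsLocalRing.le_maximalIdeal hQp.ne_top h
            have h6 : (1 : B) ∈ maximalIdeal B :=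
              (Ideal.add_mem_iff_left _ (Ideal.mul_mem_right _ _ hwM)).1 h5
            exact (maximalIdeal.isMaximal B).ne_top ((Ideal.eq_top_iff_one _).2 h6)
        · intro hij
          have := hw' j hij Q hQ
          exact Q.add_mem this (Q.mul_mem_right _ (Ideal.pow_mem_of_mem _ this 2 (by norm_num)))
      choose v hv using hv
      exact ⟨v, hv⟩

theorem statement0
    (B : Type u) [CommRing B] [IsNoetherianRing B] [IsLocalRing B] [IsReduced B]
    [Algebra ℚ B] [Uncountable (ResidueField B)]
    (hcard : Cardinal.mk B = Cardinal.mk (ResidueField B))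
    (m : ℕ) (hm : 1 ≤ m) (C : Fin m → Set (Ideal B))
    (hCne : ∀ i, (C i).Nonempty)
    (hCdisj : ∀ i j, i ≠ j → Disjoint (C i) (C j))
    (hCunion : (⋃ i, C i) = minimalPrimes B) :
    ∃ S : Subring B, ∃ hS : IsLocalRing ↥S,
      letI := hS
      IsNoetherianRing ↥S ∧ IsReduced ↥S ∧
      -- `S` is a local subring with maximal ideal `S ∩ M`
      maximalIdeal ↥S = (maximalIdeal B).comap S.subtype ∧
      -- (1) `S` contains the rationals
      Set.range (algebraMap ℚ B) ⊆ (S : Set B) ∧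
      -- (2) the completion of `S` (at `S ∩ M`) is the completion of `B` (at `M`),
      -- via an isomorphism compatible with the inclusion `S ⊆ B`
      (∃ e : AdicCompletion (maximalIdeal ↥S) ↥S ≃+* AdicCompletion (maximalIdeal B) B,
        ∀ s : ↥S, e (algebraMap ↥S (AdicCompletion (maximalIdeal ↥S) ↥S) s) =
          algebraMap B (AdicCompletion (maximalIdeal B) B) (s : B)) ∧
      -- (3) `S/(S ∩ M)` is uncountable and `|S| = |S/(S ∩ M)|`
      Uncountable (ResidueField ↥S) ∧
      Cardinal.mk ↥S = Cardinal.mk (ResidueField ↥S) ∧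
      -- (4) minimal primes are glued exactly according to the partition
      (∀ Q ∈ minimalPrimes B, ∀ Q' ∈ minimalPrimes B,
        (Q.comap S.subtype = Q'.comap S.subtype ↔ ∃ i, Q ∈ C i ∧ Q' ∈ C i)) ∧
      -- (5) the contraction map `Spec B → Spec S` is onto ...
      (∀ q : Ideal ↥S, q.IsPrime → ∃ P : Ideal B, P.IsPrime ∧ P.comap S.subtype = q) ∧
      -- ... and `f(P)B = P` for primes `P` of positive height ...
      (∀ (P : Ideal B) (hP : P.IsPrime),
        0 < Order.height (⟨P, hP⟩ : PrimeSpectrum B) →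
        (P.comap S.subtype).map S.subtype = P) ∧
      -- ... in particular, for primes `P`, `P'` of positive height, `f(P)` has positive
      -- height and `f(P) = f(P')` implies `P = P'`
      (∀ (P P' : Ideal B) (hP : P.IsPrime) (hP' : P'.IsPrime),
        0 < Order.height (⟨P, hP⟩ : PrimeSpectrum B) →
        0 < Order.height (⟨P', hP'⟩ : PrimeSpectrum B) →
        0 < Order.height (⟨P.comap S.subtype, hP.comap S.subtype⟩ : PrimeSpectrum ↥S) ∧
        (P.comap S.subtype = P'.comap S.subtype → P = P')) := by
  have hunc : Cardinal.aleph0 < Cardinal.mk (ResidueField B) :=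
    Cardinal.aleph0_lt_mk
  have hC : ∀ i, C i ⊆ minimalPrimes B := fun i => hCunion ▸ Set.subset_iUnion C i
  have hCmem : ∀ Q ∈ minimalPrimes B, ∃ i, Q ∈ C i := by
    intro Q hQ
    rw [← hCunion] at hQ
    exact Set.mem_iUnion.1 hQ
  obtain ⟨S, h1, h2, h3, ⟨v, hv⟩, hfield⟩ := glue_setup hunc hcard C hCne hCdisj hCunion
  -- local
  have hloc : IsLocalHom S.subtype := by
    refine ⟨fun s hs => ?_⟩
    obtain ⟨b, hb⟩ := hs.exists_right_inv
    have hb' : (s : B) * b = 1 := hb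
    have hbS : b ∈ S := h3 s s.2 (GlueReg.of_isUnit hs) b (by rw [hb']; exact S.one_mem)
    exact IsUnit.of_mul_eq_one ⟨b, hbS⟩ (Subtype.ext hb')
  have hS : IsLocalRing S := RingHom.domain_isLocalRing S.subtype
  have hmax : maximalIdeal S = (maximalIdeal B).comap S.subtype :=
    (((IsLocalRing.local_hom_TFAE S.subtype).out 0 4 :
      IsLocalHom S.subtype ↔ (maximalIdeal B).comap S.subtype = maximalIdeal S).1 hloc).symm
  -- a regular element of any nonminimal prime lying in S
  have hreg : ∀ P : Ideal B, P.IsPrime → P ∉ minimalPrimes B →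
      ∃ s : S, (s : B) ∈ P ∧ GlueReg (s : B) := by
    intro P hP hPm
    obtain ⟨r, hrP, hr⟩ := glue_avoid P (minimalPrimes B) subset_rfl (by
      intro Q hQ hle
      apply hPm
      have : P = Q := le_antisymm hle (hQ.2 ⟨hP, bot_le⟩ hle)
      rw [this]; exact hQ)
    obtain ⟨x, hx⟩ := h2 (r ^ 2) (GlueReg.pow hr 2) r
    have e : r + r ^ 2 * x = r * (1 + r * x) := by ring
    rw [e] at hx
    refine ⟨⟨_, hx⟩, ?_, ?_⟩
    · exact P.mul_mem_right _ hrP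
    · refine GlueReg.mul hr (GlueReg.of_isUnit ?_)
      by_contra hu
      have h5 : 1 + r * x ∈ maximalIdeal B := hu
      have h6 : (1 : B) ∈ maximalIdeal B :=
        (Ideal.add_mem_iff_left _ (Ideal.mul_mem_right _ _
          (IsLocalRing.le_maximalIdeal hP.ne_top hrP))).1 h5
      exact (maximalIdeal.isMaximal B).ne_top ((Ideal.eq_top_iff_one _).2 h6)
  have hmap : ∀ P : Ideal B, P.IsPrime → P ∉ minimalPrimes B →
      (P.comap S.subtype).map S.subtype = P := by
    intro P hP hPm
    refine le_antisymm Ideal.map_comap_le ?_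
    obtain ⟨s, hsP, hsr⟩ := hreg P hP hPm
    intro p hp
    obtain ⟨x, hx⟩ := h2 s hsr p
    have e : p = S.subtype ⟨_, hx⟩ - S.subtype s * x := by simp
    rw [e]
    refine Ideal.sub_mem _ (Ideal.mem_map_of_mem _ ?_)
      (Ideal.mul_mem_right _ _ (Ideal.mem_map_of_mem _ hsP))
    exact P.add_mem hp (P.mul_mem_right _ hsP)
  -- structure of primes without regular elements
  have hvsum : GlueReg ((∑ j, v j : S) : B) := by
    intro Q hQ hs
    obtain ⟨i, hi⟩ := hCmem Q hQ
    rw [← Finset.add_sum_erase _ _ (Finset.mem_univ i), Subring.coe_add] at hs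
    refine (hv i i Q hi).1 ?_ rfl
    refine (Ideal.add_mem_iff_left _ ?_).1 hs
    rw [AddSubmonoidClass.coe_finsetSum]
    refine Ideal.sum_mem _ fun j hj => ?_
    exact (hv j i Q hi).2 (Finset.ne_of_mem_erase hj)
  have hpv : ∀ i, ∀ Q ∈ C i, ∀ z : S, (z : B) ∈ Q → z * v i = 0 := by
    intro i Q hQ z hz
    apply Subtype.ext
    refine GlueReg.eq_zero fun P hP => ?_
    obtain ⟨j, hj⟩ := hCmem P hP
    rw [Subring.coe_mul]
    by_cases hij : i = j
    · subst hij
      exact P.mul_mem_right _ (h1 z z.2 i Q hQ P hj hz)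
    · exact P.mul_mem_left _ ((hv i j P hj).2 hij)
  have hprimes : ∀ q : Ideal S, q.IsPrime → (∃ s ∈ q, GlueReg (s : B)) ∨
      ∃ i, ∀ Q ∈ C i, Q.comap S.subtype = q := by
    intro q hq
    by_cases hr : ∃ s ∈ q, GlueReg (s : B)
    · exact Or.inl hr
    right
    have : ∃ i, v i ∉ q := by
      by_contra! h
      exact hr ⟨∑ j, v j, Ideal.sum_mem _ fun j _ => h j, hvsum⟩
    obtain ⟨i, hi⟩ := this
    refine ⟨i, fun Q hQ => le_antisymm ?_ ?_⟩
    · intro z hz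
      have h0 := hpv i Q hQ z hz
      refine (hq.mem_or_mem (?_ : z * v i ∈ q)).resolve_right hi
      rw [h0]; exact q.zero_mem
    · intro z hz
      by_contra hzQ
      apply hr
      refine ⟨z * v i + ∑ j ∈ Finset.univ.erase i, v j, ?_, ?_⟩
      · refine q.add_mem (q.mul_mem_right _ hz) (Ideal.sum_mem _ fun j hj => ?_)
        have hji := Finset.ne_of_mem_erase hj
        have h0 := hpv i Q hQ (v j) ((hv j i Q hQ).2 hji)
        refine (hq.mem_or_mem (?_ : v j * v i ∈ q)).resolve_right hi
        rw [h0]; exact q.zero_mem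
      · intro P hP hs
        have hPp : P.IsPrime := hP.1.1
        obtain ⟨k, hk⟩ := hCmem P hP
        rw [Subring.coe_add, Subring.coe_mul, AddSubmonoidClass.coe_finsetSum] at hs
        by_cases hik : i = k
        · subst hik
          rw [Ideal.add_mem_iff_left _ (Ideal.sum_mem _ fun j hj =>
            (hv j i P hk).2 (Finset.ne_of_mem_erase hj))] at hs
          rcases hPp.mem_or_mem hs with h | h
          · exact hzQ (h1 z z.2 i P hk Q hQ h)
          · exact (hv i i P hk).1 h rfl
        · rw [Ideal.add_mem_iff_right _ (P.mul_mem_left _ ((hv i k P hk).2 hik)),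
            ← Finset.add_sum_erase _ _ (Finset.mem_erase.2 ⟨Ne.symm hik, Finset.mem_univ k⟩)] at hs
          refine (hv k k P hk).1 ?_ rfl
          refine (Ideal.add_mem_iff_left _ ?_).1 hs
          exact Ideal.sum_mem _ fun j hj => (hv j k P hk).2 (Finset.ne_of_mem_erase hj)
  have hnoeth : IsNoetherianRing S := by
    refine IsNoetherianRing.of_prime fun q hq => ?_
    rcases hprimes q hq with ⟨s, hs, hr⟩ | ⟨i, hi⟩
    · exact glue_fg S h2 h3 q s hs hr
    obtain ⟨Q, hQ⟩ := hCne i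
    have hqQ := hi Q hQ
    have hbig : (q ⊔ Ideal.span {v i}).FG := by
      refine glue_fg S h2 h3 _ (∑ j, v j) ?_ hvsum
      rw [← Finset.sum_erase_add _ _ (Finset.mem_univ i)]
      refine Ideal.add_mem _ (Ideal.mem_sup_left (Ideal.sum_mem _ fun j hj => ?_))
        (Ideal.mem_sup_right (Ideal.mem_span_singleton_self _))
      rw [← hqQ]
      exact (hv j i Q hQ).2 (Finset.ne_of_mem_erase hj)
    refine Submodule.fg_of_fg_map_of_fg_inf_ker (Submodule.mkQ (Ideal.span {v i})) ?_ ?_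
    · have := Submodule.FG.map (Submodule.mkQ (Ideal.span {v i})) hbig
      rw [Submodule.map_sup] at this
      have h0 : Submodule.map (Submodule.mkQ (Ideal.span {v i})) (Ideal.span {v i}) = ⊥ := by
        rw [Submodule.mkQ_map_self]
      rwa [h0, sup_bot_eq] at this
    · have : q ⊓ LinearMap.ker (Submodule.mkQ (Ideal.span {v i})) = ⊥ := by
        rw [Submodule.ker_mkQ, eq_bot_iff]
        rintro z ⟨hz, hz'⟩
        obtain ⟨y, rfl⟩ := Ideal.mem_span_singleton'.1 hz'
        rw [← hqQ] at hz
        have hz1 : (y : B) * v i ∈ Q := hz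
        have hy : (y : B) ∈ Q := ((hC i hQ).1.1.mem_or_mem hz1).resolve_right
          fun h => (hv i i Q hQ).1 h rfl
        exact hpv i Q hQ y hy
      rw [this]; exact Submodule.fg_bot
  -- the maximal ideal
  have hMmap : (maximalIdeal S).map S.subtype = maximalIdeal B := by
    rw [hmax]
    by_cases hM : maximalIdeal B ∈ minimalPrimes B
    · have hT := hfield hM
      refine Ideal.map_comap_of_surjective _ (fun b => ⟨⟨b, ?_⟩, rfl⟩) _
      rw [hT]; trivial
    · exact hmap _ inferInstance hM
  have hpow : ∀ k, maximalIdeal S ^ k = (maximalIdeal B ^ k).comap S.subtype := by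
    intro k
    rw [← hMmap, ← Ideal.map_pow]
    by_cases hM : maximalIdeal B ∈ minimalPrimes B
    · have hT := hfield hM
      refine (Ideal.comap_map_of_bijective _ ⟨Subtype.val_injective, fun b => ⟨⟨b, ?_⟩, rfl⟩⟩).symm
      rw [hT]; trivial
    · obtain ⟨s, hs, hr⟩ := hreg _ inferInstance hM
      refine (glue_comap_map S h2 h3 _ (s ^ k) ?_ ?_).symm
      · refine Ideal.pow_mem_pow ?_ k
        rw [hmax]; exact hs
      · rw [Subring.coe_pow]; exact hr.pow k
  have hdense : ∀ k b, ∃ a : S, b - S.subtype a ∈ maximalIdeal B ^ k := by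
    intro k b
    by_cases hM : maximalIdeal B ∈ minimalPrimes B
    · have hT := hfield hM
      refine ⟨⟨b, by rw [hT]; trivial⟩, ?_⟩
      simp
    · obtain ⟨s, hs, hr⟩ := hreg _ inferInstance hM
      obtain ⟨x, hx⟩ := h2 ((s : B) ^ k) (hr.pow k) b
      refine ⟨⟨_, hx⟩, ?_⟩
      have e : b - S.subtype ⟨_, hx⟩ = - ((s : B) ^ k * x) := by simp
      rw [e]
      exact neg_mem (Ideal.mul_mem_right _ _ (Ideal.pow_mem_pow hs k))
  have hressurj : Function.Surjective (IsLocalRing.ResidueField.map S.subtype) := by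
    intro r
    obtain ⟨b, rfl⟩ := IsLocalRing.residue_surjective r
    obtain ⟨a, ha⟩ := hdense 1 b
    refine ⟨residue S a, ?_⟩
    rw [IsLocalRing.ResidueField.map_residue]
    rw [pow_one] at ha
    exact ((Ideal.Quotient.eq).2 ha).symm
  have hnm : ∀ (P : Ideal B) (hP : P.IsPrime),
      0 < Order.height (⟨P, hP⟩ : PrimeSpectrum B) → P ∉ minimalPrimes B := by
    intro P hP hpos hmin
    have h0 : Order.height (⟨P, hP⟩ : PrimeSpectrum B) = 0 := by
      rw [Order.height_eq_zero, PrimeSpectrum.isMin_iff]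
      exact hmin
    rw [h0] at hpos
    exact hpos.false
  refine ⟨S, hS, hnoeth, ?_, hmax, ?_, ?_, ?_, ?_, ?_, ?_, ?_, ?_⟩
  · exact isReduced_of_injective S.subtype Subtype.val_injective
  · rintro _ ⟨q, rfl⟩
    have hu : IsUnit ((q.den : ℤ) : B) := by
      have : IsUnit (algebraMap ℚ B ((q.den : ℤ) : ℚ)) :=
        (IsUnit.mk0 _ (by exact_mod_cast q.den_ne_zero)).map _
      simpa using this
    refine h3 ((q.den : ℤ) : B) (intCast_mem S _) (GlueReg.of_isUnit hu) _ ?_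
    have : ((q.den : ℤ) : B) * algebraMap ℚ B q = (q.num : B) := by
      rw [← map_intCast (algebraMap ℚ B), ← map_intCast (algebraMap ℚ B) q.num, ← map_mul]
      congr 1
      push_cast
      exact Rat.den_mul_eq_num q
    rw [this]
    exact intCast_mem S _
  · exact glue_completion S.subtype _ _ hpow hdense
  · exact hressurj.uncountable
  · refine le_antisymm ?_ (Cardinal.mk_le_of_surjective IsLocalRing.residue_surjective)
    calc Cardinal.mk S ≤ Cardinal.mk B := Cardinal.mk_le_of_injective Subtype.val_injective
      _ = _ := hcard
      _ ≤ _ := Cardinal.mk_le_of_surjective hressurj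
  · intro Q hQ Q' hQ'
    constructor
    · intro h
      obtain ⟨i, hi⟩ := hCmem Q hQ
      obtain ⟨j, hj⟩ := hCmem Q' hQ'
      by_cases hij : i = j
      · subst hij; exact ⟨i, hi, hj⟩
      · exfalso
        have h5 : v i ∈ Q'.comap S.subtype := (hv i j Q' hj).2 hij
        rw [← h] at h5
        exact (hv i i Q hi).1 h5 rfl
    · rintro ⟨i, hi, hi'⟩
      ext z
      exact ⟨h1 z z.2 i Q hi Q' hi', h1 z z.2 i Q' hi' Q hi⟩
  · intro q hq
    rcases hprimes q hq with ⟨s, hs, hr⟩ | ⟨i, hi⟩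
    · exact (Ideal.comap_map_eq_self_iff_of_isPrime q).1 (glue_comap_map S h2 h3 q s hs hr)
    · obtain ⟨Q, hQ⟩ := hCne i
      exact ⟨Q, (hC i hQ).1.1, hi Q hQ⟩
  · intro P hP hpos
    exact hmap P hP (hnm P hP hpos)
  · intro P P' hP hP' hpos hpos'
    have e := hmap P hP (hnm P hP hpos)
    refine ⟨?_, ?_⟩
    · rw [pos_iff_ne_zero, Ne, Order.height_eq_zero, PrimeSpectrum.isMin_iff]
      intro hmin
      obtain ⟨Q, hQ, hQP⟩ := Ideal.exists_minimalPrimes_le (I := (⊥ : Ideal B)) (J := P) bot_le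
      have hQp : Q.IsPrime := hQ.1.1
      have hle : P.comap S.subtype ≤ Q.comap S.subtype :=
        hmin.2 ⟨hQp.comap S.subtype, bot_le⟩ (Ideal.comap_mono hQP)
      have hPQ : P ≤ Q := by
        rw [← e]; exact Ideal.map_le_iff_le_comap.2 hle
      exact hnm P hP hpos (le_antisymm hPQ hQP ▸ hQ)
    · intro h
      rw [← e, h, hmap P' hP' (hnm P' hP' hpos')]
end

section
/- Let J = (x₁, x₅) ∩ (x₁, x₆, x₇) ∩ (x₂, x₃, x₅) ∩ (x₂, x₃, x₆, x₇) in the formal power series ring ℂ[[x₁, …, x₈]], let T = ℂ[[x₁, …, x₈]]/J, and let Q₁ = (x₁, x₅, x₆, x₇, x₈)/J and Q₂ = (x₂, x₃, x₅, x₆, x₇, x₈)/J. Then Q₁ and Q₂ are prime ideals of T, T/(Q₁ ∩ Q₂) is isomorphic to T̄ := ℂ[[x₁, x₂, x₃, x₄]]/((x₁) ∩ (x₂, x₃)), and there is a ring isomorphism T̄[[y₁, y₂, y₃, y₄]] / ((y₁) ∩ (y₂, y₃))·T̄[[y₁, y₂, y₃, y₄]] ≅ T that sends yᵢ to the image of x_{i+4}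 for i = 1, 2, 3, 4. -/
/-!
The example: with `J = (x₁,x₅) ∩ (x₁,x₆,x₇) ∩ (x₂,x₃,x₅) ∩ (x₂,x₃,x₆,x₇)` in
`ℂ[[x₁, …, x₈]]`, `T = ℂ[[x₁, …, x₈]]/J`, `Q₁ = (x₁,x₅,x₆,x₇,x₈)/J`, and
`Q₂ = (x₂,x₃,x₅,x₆,x₇,x₈)/J`: the ideals `Q₁`, `Q₂` are prime, `T/(Q₁ ∩ Q₂)` is
isomorphic to `T̄ = ℂ[[x₁,x₂,x₃,x₄]]/((x₁) ∩ (x₂,x₃))`, and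
`T̄[[y₁,y₂,y₃,y₄]]/((y₁) ∩ (y₂,y₃)) ≅ T` via `yᵢ ↦ x_{i+4}`.

`ℂ[[x₁, …, x₈]]` is modeled as `MvPowerSeries (Fin 8) ℂ`, with `xᵢ = MvPowerSeries.X (i-1)`
(zero-based indexing); similarly for `ℂ[[x₁,…,x₄]]` and `T̄[[y₁,…,y₄]]`.
-/

open MvPowerSeries

/-- The ideal `(x₁,x₅) ∩ (x₁,x₆,x₇) ∩ (x₂,x₃,x₅) ∩ (x₂,x₃,x₆,x₇)` of `ℂ[[x₁, …, x₈]]`. -/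
noncomputable def Jex : Ideal (MvPowerSeries (Fin 8) ℂ) :=
  Ideal.span {X 0, X 4} ⊓ Ideal.span {X 0, X 5, X 6} ⊓
    Ideal.span {X 1, X 2, X 4} ⊓ Ideal.span {X 1, X 2, X 5, X 6}

/-- `T = ℂ[[x₁, …, x₈]]/J`. -/
abbrev Tex : Type := MvPowerSeries (Fin 8) ℂ ⧸ Jex

/-- `Q₁ = (x₁, x₅, x₆, x₇, x₈)/J`. -/
noncomputable def Q1ex : Ideal Tex :=
  (Ideal.span {X 0, X 4, X 5, X 6, X 7}).map (Ideal.Quotient.mk Jex)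

/-- `Q₂ = (x₂, x₃, x₅, x₆, x₇, x₈)/J`. -/
noncomputable def Q2ex : Ideal Tex :=
  (Ideal.span {X 1, X 2, X 4, X 5, X 6, X 7}).map (Ideal.Quotient.mk Jex)

/-- `T̄ = ℂ[[x₁, x₂, x₃, x₄]]/((x₁) ∩ (x₂, x₃))`. -/
abbrev TbarEx : Type :=
  MvPowerSeries (Fin 4) ℂ ⧸
    (Ideal.span {X 0} ⊓ Ideal.span {(X 1 : MvPowerSeries (Fin 4) ℂ), X 2})

/-- The ideal `(y₁) ∩ (y₂, y₃)` of `T̄[[y₁, y₂, y₃, y₄]]`. -/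
noncomputable def KbarEx : Ideal (MvPowerSeries (Fin 4) TbarEx) :=
  Ideal.span {X 0} ⊓ Ideal.span {(X 1 : MvPowerSeries (Fin 4) TbarEx), X 2}

namespace Ex13

theorem mem_span_X_iff {σ R : Type*} [CommRing R] (S : Finset σ) (f : MvPowerSeries σ R) :
    f ∈ Ideal.span ((fun i => (X i : MvPowerSeries σ R)) '' (S : Set σ)) ↔
      ∀ d : σ →₀ ℕ, (∀ i ∈ S, d i = 0) → coeff d f = 0 := by
  classical
  constructor
  · intro hf
    induction hf using Submodule.span_induction with
    | mem x hx =>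
      obtain ⟨i, hi, rfl⟩ := hx
      exact fun d hd => X_dvd_iff.1 dvd_rfl d (hd i hi)
    | zero => simp
    | add x y _ _ hx hy => intro d hd; rw [map_add, hx d hd, hy d hd, add_zero]
    | smul a x _ hx =>
      intro d hd
      rw [smul_eq_mul, coeff_mul]
      apply Finset.sum_eq_zero
      intro p hp
      have h := Finset.HasAntidiagonal.mem_antidiagonal.1 hp
      rw [hx p.2 ?_, mul_zero]
      intro i hi
      have h2 := hd i hi
      rw [← h, Finsupp.add_apply] at h2
      omega
  · induction S using Finset.induction_on generalizing f with
    | empty =>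
      intro h
      have : f = 0 := by ext d; simpa using h d (by simp)
      rw [this]; exact zero_mem _
    | insert i S hi ih =>
      intro h
      let f0 : MvPowerSeries σ R := fun d => if d i = 0 then coeff d f else 0
      have hf0 : ∀ d, coeff d f0 = if d i = 0 then coeff d f else 0 := fun d => rfl
      have h1 : X i ∣ f - f0 := by
        rw [X_dvd_iff]
        intro d hd
        rw [map_sub, hf0, if_pos hd, sub_self]
      have h2 := ih f0 (by
        intro d hd
        rw [hf0]
        split_ifs with h0
        · apply h
          intro j hj
          rcases Finset.mem_insert.1 hj with rfl | hj
          · exact h0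
          · exact hd j hj
        · rfl)
      have h3 : f = (f - f0) + f0 := by ring
      rw [h3]
      apply add_mem
      · exact Ideal.mem_of_dvd _ h1 (Ideal.subset_span ⟨i, by simp, rfl⟩)
      · exact Ideal.span_mono (Set.image_mono (by simp)) h2

theorem prime_span_X {σ R : Type*} [CommRing R] [IsDomain R] (S : Finset σ) :
    (Ideal.span ((fun i => (X i : MvPowerSeries σ R)) '' (S : Set σ))).IsPrime := by
  classical
  have : Ideal.span ((fun i => (X i : MvPowerSeries σ R)) '' (S : Set σ)) =
      RingHom.ker (rescale (fun i => if i ∈ S then (0 : R) else 1)) := by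
    ext f
    rw [mem_span_X_iff, RingHom.mem_ker, MvPowerSeries.ext_iff]
    apply forall_congr'
    intro d
    rw [coeff_rescale, map_zero]
    by_cases h : ∀ i ∈ S, d i = 0
    · have : (d.prod fun s m ↦ (if s ∈ S then (0 : R) else 1) ^ m) = 1 := by
        apply Finset.prod_eq_one
        intro i hi
        have : i ∉ S := fun h' => (Finsupp.mem_support_iff.1 hi) (h i h')
        simp [this]
      rw [this, one_mul]
      exact ⟨fun h' => h' h, fun h' _ => h'⟩
    · have : (d.prod fun s m ↦ (if s ∈ S then (0 : R) else 1) ^ m) = 0 := by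
        push Not at h
        obtain ⟨i, hi, h⟩ := h
        apply Finset.prod_eq_zero (Finsupp.mem_support_iff.2 h)
        simp [hi, h]
      rw [this, zero_mul]
      exact ⟨fun _ => rfl, fun _ h' => absurd h' h⟩
  rw [this]
  have : IsDomain (MvPowerSeries σ R) := NoZeroDivisors.to_isDomain _
  exact RingHom.ker_isPrime _

theorem mem_span1 {σ R : Type*} [CommRing R] (a : σ) (f : MvPowerSeries σ R) :
    f ∈ Ideal.span {(X a : MvPowerSeries σ R)} ↔ ∀ d : σ →₀ ℕ, d a = 0 → coeff d f = 0 := by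
  classical
  simpa [Set.image_insert_eq] using mem_span_X_iff {a} f

theorem mem_span2 {σ R : Type*} [CommRing R] (a b : σ) (f : MvPowerSeries σ R) :
    f ∈ Ideal.span {(X a : MvPowerSeries σ R), X b} ↔
      ∀ d : σ →₀ ℕ, d a = 0 → d b = 0 → coeff d f = 0 := by
  classical
  simpa [Set.image_insert_eq] using mem_span_X_iff {a, b} f

theorem mem_span3 {σ R : Type*} [CommRing R] (a b c : σ) (f : MvPowerSeries σ R) :
    f ∈ Ideal.span {(X a : MvPowerSeries σ R), X b, X c} ↔
      ∀ d : σ →₀ ℕ, d a = 0 → d b = 0 → d c = 0 → coeff d f = 0 := by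
  classical
  simpa [Set.image_insert_eq] using mem_span_X_iff {a, b, c} f

theorem mem_span4 {σ R : Type*} [CommRing R] (a b c e : σ) (f : MvPowerSeries σ R) :
    f ∈ Ideal.span {(X a : MvPowerSeries σ R), X b, X c, X e} ↔
      ∀ d : σ →₀ ℕ, d a = 0 → d b = 0 → d c = 0 → d e = 0 → coeff d f = 0 := by
  classical
  simpa [Set.image_insert_eq] using mem_span_X_iff {a, b, c, e} f

noncomputable def join (e e' : Fin 4 →₀ ℕ) : Fin 8 →₀ ℕ :=
  Finsupp.equivFunOnFinite.symm ![e 0, e 1, e 2, e 3, e' 0, e' 1, e' 2, e' 3]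
noncomputable def lo (d : Fin 8 →₀ ℕ) : Fin 4 →₀ ℕ :=
  Finsupp.equivFunOnFinite.symm ![d 0, d 1, d 2, d 3]
noncomputable def hi (d : Fin 8 →₀ ℕ) : Fin 4 →₀ ℕ :=
  Finsupp.equivFunOnFinite.symm ![d 4, d 5, d 6, d 7]

@[simp] theorem lo_join (e e') : lo (join e e') = e := by
  ext i; fin_cases i <;> rfl
@[simp] theorem hi_join (e e') : hi (join e e') = e' := by
  ext i; fin_cases i <;> rfl
@[simp] theorem join_lo_hi (d) : join (lo d) (hi d) = d := by
  ext i; fin_cases i <;> rfl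
theorem join_add (a b a' b') : join (a + b) (a' + b') = join a a' + join b b' := by
  ext i; fin_cases i <;> rfl
theorem lo_add (a b) : lo (a + b) = lo a + lo b := by
  ext i; fin_cases i <;> rfl
theorem hi_add (a b) : hi (a + b) = hi a + hi b := by
  ext i; fin_cases i <;> rfl
theorem join_eq_iff (e e' d) : join e e' = d ↔ e = lo d ∧ e' = hi d := by
  constructor
  · rintro rfl; simp
  · rintro ⟨rfl, rfl⟩; simp

variable {R : Type*} [CommRing R]

noncomputable def splitFun (f : MvPowerSeries (Fin 8) R) :
    MvPowerSeries (Fin 4) (MvPowerSeries (Fin 4) R) :=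
  fun e' => (fun e => coeff (join e e') f : MvPowerSeries (Fin 4) R)

theorem coeff_splitFun (f : MvPowerSeries (Fin 8) R) (e e') :
    coeff e (coeff e' (splitFun f)) = coeff (join e e') f := rfl

theorem lo_zero : lo 0 = 0 := by ext i; fin_cases i <;> rfl
theorem hi_zero : hi 0 = 0 := by ext i; fin_cases i <;> rfl

noncomputable def split :
    MvPowerSeries (Fin 8) R →+* MvPowerSeries (Fin 4) (MvPowerSeries (Fin 4) R) where
  toFun := splitFun
  map_zero' := by ext; simp [coeff_splitFun]
  map_add' f g := by ext; simp [coeff_splitFun]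
  map_one' := by
    classical
    ext e' e
    rw [coeff_splitFun, coeff_one, coeff_one]
    simp only [join_eq_iff, lo_zero, hi_zero]
    by_cases h : e' = 0
    · simp [h, coeff_one]
    · simp [h]
  map_mul' f g := by
    classical
    ext e' e
    rw [coeff_splitFun, coeff_mul, coeff_mul, map_sum]
    simp only [coeff_mul, coeff_splitFun]
    rw [← Finset.sum_product']
    refine Finset.sum_nbij' (fun p => ((hi p.1, hi p.2), (lo p.1, lo p.2)))
      (fun q => (join q.2.1 q.1.1, join q.2.2 q.1.2)) ?_ ?_ ?_ ?_ ?_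
    · rintro ⟨a, b⟩ h
      simp only [Finset.HasAntidiagonal.mem_antidiagonal, Finset.mem_product] at h ⊢
      rw [← hi_add, ← lo_add, h]; simp
    · rintro ⟨⟨a, b⟩, ⟨c, d⟩⟩ h
      simp only [Finset.HasAntidiagonal.mem_antidiagonal, Finset.mem_product] at h ⊢
      rw [← join_add, h.1, h.2]
    · rintro ⟨a, b⟩ h; simp
    · rintro ⟨⟨a, b⟩, ⟨c, d⟩⟩ h; simp
    · rintro ⟨a, b⟩ h; simp

theorem coeff_split (f : MvPowerSeries (Fin 8) R) (e e') :
    coeff e (coeff e' (split f)) = coeff (join e e') f := rfl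

theorem split_surj : Function.Surjective (split (R := R)) := by
  intro F
  refine ⟨fun d => coeff (lo d) (coeff (hi d) F), ?_⟩
  ext e' e
  change coeff (lo (join e e')) (coeff (hi (join e e')) F) = _
  simp

theorem split_X (i : Fin 4) (hlt : i.1 + 4 < 8) :
    split (X (⟨i.1 + 4, hlt⟩ : Fin 8) : MvPowerSeries (Fin 8) R) = X i := by
  classical
  ext e' e
  rw [coeff_split, coeff_X, coeff_X]
  have h1 : lo (Finsupp.single (⟨i.1 + 4, hlt⟩ : Fin 8) 1) = 0 := by
    ext j; fin_cases i <;> fin_cases j <;> simp [lo]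
  have h2 : hi (Finsupp.single (⟨i.1 + 4, hlt⟩ : Fin 8) 1) = Finsupp.single i 1 := by
    ext j; fin_cases i <;> fin_cases j <;> simp [hi]
  simp only [join_eq_iff, h1, h2]
  by_cases h : e' = Finsupp.single i 1
  · simp [h, coeff_one]
  · simp [h]

theorem mapp_surj {σ A B : Type*} [CommRing A] [CommRing B] (f : A →+* B)
    (hf : Function.Surjective f) : Function.Surjective (MvPowerSeries.map (σ := σ) f) := by
  intro F
  choose g hg using hf
  exact ⟨fun d => g (coeff d F), by ext d; exact hg _⟩

noncomputable abbrev Ibar : Ideal (MvPowerSeries (Fin 4) ℂ) :=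
    (Ideal.span {X 0} ⊓ Ideal.span {(X 1 : MvPowerSeries (Fin 4) ℂ), X 2})

theorem mk_eq_zero_iff (f : MvPowerSeries (Fin 4) ℂ) : Ideal.Quotient.mk Ibar f = 0 ↔
    ∀ e : Fin 4 →₀ ℕ, (e 0 = 0 ∨ (e 1 = 0 ∧ e 2 = 0)) → coeff e f = 0 := by
  rw [Ideal.Quotient.eq_zero_iff_mem, Ideal.mem_inf, mem_span1, mem_span2]
  constructor
  · rintro ⟨h1, h2⟩ e (h | h)
    · exact h1 e h
    · exact h2 e h.1 h.2
  · intro h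
    exact ⟨fun e he => h e (Or.inl he), fun e he he' => h e (Or.inr ⟨he, he'⟩)⟩

noncomputable def phi : MvPowerSeries (Fin 8) ℂ →+* MvPowerSeries (Fin 4) TbarEx :=
  (MvPowerSeries.map (Ideal.Quotient.mk Ibar)).comp split

theorem phi_surj : Function.Surjective phi :=
  (mapp_surj _ Ideal.Quotient.mk_surjective).comp split_surj

theorem coeff_phi (f : MvPowerSeries (Fin 8) ℂ) (e') : coeff e' (phi f) = 0 ↔
    ∀ e : Fin 4 →₀ ℕ, (e 0 = 0 ∨ (e 1 = 0 ∧ e 2 = 0)) → coeff (join e e') f = 0 := by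
  have : coeff e' (phi f) = Ideal.Quotient.mk Ibar (coeff e' (split f)) := rfl
  rw [this, mk_eq_zero_iff]
  rfl

theorem mem_J (f : MvPowerSeries (Fin 8) ℂ) : f ∈ Jex ↔
    ∀ d : Fin 8 →₀ ℕ, (d 0 = 0 ∨ (d 1 = 0 ∧ d 2 = 0)) → (d 4 = 0 ∨ (d 5 = 0 ∧ d 6 = 0)) →
      coeff d f = 0 := by
  unfold Jex
  simp only [Ideal.mem_inf, mem_span2, mem_span3, mem_span4]
  constructor
  · rintro ⟨⟨⟨h1, h2⟩, h3⟩, h4⟩ d (h | ⟨h, h'⟩) (k | ⟨k, k'⟩)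
    · exact h1 d h k
    · exact h2 d h k k'
    · exact h3 d h h' k
    · exact h4 d h h' k k'
  · intro h
    refine ⟨⟨⟨?_, ?_⟩, ?_⟩, ?_⟩ <;> intro d <;> intros <;> apply h d <;> tauto

theorem phi_mem_K (f : MvPowerSeries (Fin 8) ℂ) : phi f ∈ KbarEx ↔ f ∈ Jex := by
  unfold KbarEx
  rw [mem_J, Ideal.mem_inf, mem_span1, mem_span2]
  simp only [coeff_phi]
  constructor
  · rintro ⟨h1, h2⟩ d h k
    rw [← join_lo_hi d]
    rcases k with k | k
    · exact h1 (hi d) k (lo d) h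
    · exact h2 (hi d) k.1 k.2 (lo d) h
  · intro h
    exact ⟨fun e' k e h' => h (join e e') h' (Or.inl k),
      fun e' k k' e h' => h (join e e') h' (Or.inr ⟨k, k'⟩)⟩

noncomputable def psi : MvPowerSeries (Fin 8) ℂ →+* TbarEx :=
  (constantCoeff (σ := Fin 4) (R := TbarEx)).comp phi

theorem psi_surj : Function.Surjective psi := by
  intro t
  obtain ⟨f, hf⟩ := phi_surj (C t)
  exact ⟨f, by simp [psi, hf]⟩

theorem mem_I1 (f : MvPowerSeries (Fin 8) ℂ) :
    f ∈ Ideal.span {(X 0 : MvPowerSeries (Fin 8) ℂ), X 4, X 5, X 6, X 7} ↔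
    ∀ e : Fin 4 →₀ ℕ, e 0 = 0 → coeff (join e 0) f = 0 := by
  have := mem_span_X_iff {0, 4, 5, 6, 7} f
  simp only [Finset.coe_insert, Finset.coe_singleton, Set.image_insert_eq,
    Set.image_singleton] at this
  rw [this]
  constructor
  · intro h e he
    apply h
    intro i hi
    simp only [Finset.mem_insert, Finset.mem_singleton] at hi
    rcases hi with rfl | rfl | rfl | rfl | rfl <;> first | exact he | rfl
  · intro h d hd
    rw [← join_lo_hi d]
    have : hi d = 0 := by
      ext i
      fin_cases i
      · exact hd 4 (by simp)
      · exact hd 5 (by simp)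
      · exact hd 6 (by simp)
      · exact hd 7 (by simp)
    rw [this]
    exact h _ (hd 0 (by simp))

theorem mem_I2 (f : MvPowerSeries (Fin 8) ℂ) :
    f ∈ Ideal.span {(X 1 : MvPowerSeries (Fin 8) ℂ), X 2, X 4, X 5, X 6, X 7} ↔
    ∀ e : Fin 4 →₀ ℕ, e 1 = 0 → e 2 = 0 → coeff (join e 0) f = 0 := by
  have := mem_span_X_iff {1, 2, 4, 5, 6, 7} f
  simp only [Finset.coe_insert, Finset.coe_singleton, Set.image_insert_eq,
    Set.image_singleton] at this
  rw [this]
  constructor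
  · intro h e he he'
    apply h
    intro i hi
    simp only [Finset.mem_insert, Finset.mem_singleton] at hi
    rcases hi with rfl | rfl | rfl | rfl | rfl | rfl <;> first | exact he | exact he' | rfl
  · intro h d hd
    rw [← join_lo_hi d]
    have : hi d = 0 := by
      ext i
      fin_cases i
      · exact hd 4 (by simp)
      · exact hd 5 (by simp)
      · exact hd 6 (by simp)
      · exact hd 7 (by simp)
    rw [this]
    exact h _ (hd 1 (by simp)) (hd 2 (by simp))

theorem prime_I1 :
    (Ideal.span {(X 0 : MvPowerSeries (Fin 8) ℂ), X 4, X 5, X 6, X 7}).IsPrime := by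
  have := prime_span_X (R := ℂ) ({0, 4, 5, 6, 7} : Finset (Fin 8))
  simpa only [Finset.coe_insert, Finset.coe_singleton, Set.image_insert_eq,
    Set.image_singleton] using this

theorem prime_I2 :
    (Ideal.span {(X 1 : MvPowerSeries (Fin 8) ℂ), X 2, X 4, X 5, X 6, X 7}).IsPrime := by
  have := prime_span_X (R := ℂ) ({1, 2, 4, 5, 6, 7} : Finset (Fin 8))
  simpa only [Finset.coe_insert, Finset.coe_singleton, Set.image_insert_eq,
    Set.image_singleton] using this

theorem J_le_I1 : Jex ≤ Ideal.span {(X 0 : MvPowerSeries (Fin 8) ℂ), X 4, X 5, X 6, X 7} := by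
  intro f hf
  rw [mem_I1]
  rw [mem_J] at hf
  exact fun e he => hf _ (Or.inl he) (Or.inl rfl)

theorem J_le_I2 :
    Jex ≤ Ideal.span {(X 1 : MvPowerSeries (Fin 8) ℂ), X 2, X 4, X 5, X 6, X 7} := by
  intro f hf
  rw [mem_I2]
  rw [mem_J] at hf
  exact fun e he he' => hf _ (Or.inr ⟨he, he'⟩) (Or.inl rfl)

theorem mk_mem_map {A : Type*} [CommRing A] {J I : Ideal A} (h : J ≤ I) (f : A) :
    Ideal.Quotient.mk J f ∈ I.map (Ideal.Quotient.mk J) ↔ f ∈ I := by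
  rw [Ideal.mem_quotient_iff_mem h]

theorem psi_eq_zero (f : MvPowerSeries (Fin 8) ℂ) :
    psi f = 0 ↔ Ideal.Quotient.mk Jex f ∈ Q1ex ⊓ Q2ex := by
  unfold Q1ex Q2ex
  rw [Ideal.mem_inf, mk_mem_map J_le_I1, mk_mem_map J_le_I2, mem_I1, mem_I2]
  have : psi f = coeff 0 (phi f) := rfl
  rw [this, coeff_phi]
  constructor
  · intro h
    exact ⟨fun e he => h e (Or.inl he), fun e he he' => h e (Or.inr ⟨he, he'⟩)⟩
  · rintro ⟨h1, h2⟩ e (h | h)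
    · exact h1 e h
    · exact h2 e h.1 h.2

theorem J_le_ker : ∀ f ∈ Jex, psi f = 0 := by
  intro f hf
  rw [psi_eq_zero, Ideal.Quotient.eq_zero_iff_mem.2 hf]
  exact zero_mem _

noncomputable def psibar : Tex →+* TbarEx := Ideal.Quotient.lift Jex psi J_le_ker

theorem ker_psibar : RingHom.ker psibar = Q1ex ⊓ Q2ex := by
  ext t
  obtain ⟨f, rfl⟩ := Ideal.Quotient.mk_surjective t
  rw [← psi_eq_zero]
  rfl

theorem psibar_surj : Function.Surjective psibar :=
  Ideal.Quotient.lift_surjective_of_surjective _ _ psi_surj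

noncomputable def phibar : MvPowerSeries (Fin 8) ℂ →+* MvPowerSeries (Fin 4) TbarEx ⧸ KbarEx :=
  (Ideal.Quotient.mk KbarEx).comp phi

theorem ker_phibar : Jex = RingHom.ker phibar := by
  ext f
  rw [← phi_mem_K, ← Ideal.Quotient.eq_zero_iff_mem]
  rfl

theorem phibar_surj : Function.Surjective phibar :=
  Ideal.Quotient.mk_surjective.comp phi_surj

noncomputable def eqv : Tex ≃+* MvPowerSeries (Fin 4) TbarEx ⧸ KbarEx :=
  (Ideal.quotEquivOfEq ker_phibar).trans (RingHom.quotientKerEquivOfSurjective phibar_surj)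

theorem eqv_mk (f : MvPowerSeries (Fin 8) ℂ) : eqv (Ideal.Quotient.mk Jex f) = phibar f := rfl

end Ex13

theorem statement13 :
    -- `Q₁` and `Q₂` are prime ideals of `T`
    Q1ex.IsPrime ∧ Q2ex.IsPrime ∧
    -- `T/(Q₁ ∩ Q₂) ≅ T̄`
    Nonempty ((Tex ⧸ (Q1ex ⊓ Q2ex)) ≃+* TbarEx) ∧
    -- `T̄[[y₁, y₂, y₃, y₄]]/((y₁) ∩ (y₂, y₃))·T̄[[y₁, y₂, y₃, y₄]] ≅ T`, via an
    -- isomorphism sending `yᵢ` to the image of `x_{i+4}`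
    ∃ e : (MvPowerSeries (Fin 4) TbarEx ⧸ KbarEx) ≃+* Tex,
      ∀ i : Fin 4,
        e (Ideal.Quotient.mk KbarEx (X i)) =
          Ideal.Quotient.mk Jex (X (⟨i.1 + 4, by omega⟩ : Fin 8)) := by
  refine ⟨?_, ?_, ?_, Ex13.eqv.symm, ?_⟩
  · have := Ex13.prime_I1
    exact Ideal.map_isPrime_of_surjective Ideal.Quotient.mk_surjective
      (by rw [Ideal.mk_ker]; exact Ex13.J_le_I1)
  · have := Ex13.prime_I2
    exact Ideal.map_isPrime_of_surjective Ideal.Quotient.mk_surjective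
      (by rw [Ideal.mk_ker]; exact Ex13.J_le_I2)
  · exact ⟨(Ideal.quotEquivOfEq Ex13.ker_psibar.symm).trans
      (RingHom.quotientKerEquivOfSurjective Ex13.psibar_surj)⟩
  · intro i
    rw [RingEquiv.symm_apply_eq, Ex13.eqv_mk]
    unfold Ex13.phibar Ex13.phi
    simp only [RingHom.comp_apply, Ex13.split_X, MvPowerSeries.map_X]
end
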